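/- arXiv:1703.08834 — 4 statements merged into one kernel-verified Lean document; each statement's English description precedes it below -/
import Mathlib

section
/- Let G be a finite group and T a minimal separating set of the power graph 𝒢(G). Then for every x ∈ G, either [x] ⊆ T or [x] ∩ T = ∅; hence T is a union of ≈-classes. -/
open SimpleGraph

/-- The power graph of a (multiplicative) group: distinct `x, y` are adjacent
iff one is a power of the other. -/
def powerGraph (G : Type*) [Group G] : SimpleGraph G where
  Adj x y := x ≠ y ∧ (x ∈ Subgroup.zpowers y ∨ y ∈ Subgroup.zpowers x)
  symm := by
    refine ⟨?_⟩
    rintro x y ⟨h1, h2⟩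
    exact ⟨h1.symm, h2.symm⟩
  loopless := by
    refine ⟨?_⟩
    rintro x ⟨h1, -⟩
    exact h1 rfl

/-- The power graph of the additive group `ℤ_n`. -/
def powerGraphZ (n : ℕ) : SimpleGraph (ZMod n) where
  Adj x y := x ≠ y ∧ (x ∈ AddSubgroup.zmultiples y ∨ y ∈ AddSubgroup.zmultiples x)
  symm := by
    refine ⟨?_⟩
    rintro x y ⟨h1, h2⟩
    exact ⟨h1.symm, h2.symm⟩
  loopless := by
    refine ⟨?_⟩
    rintro x ⟨h1, -⟩
    exact h1 rfl

/-- Number of connected components of a graph. -/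
noncomputable def numComponents {V : Type*} (Γ : SimpleGraph V) : ℕ :=
  Nat.card Γ.ConnectedComponent

/-- `T` is a separating set of `Γ`: deleting `T` increases the number of components. -/
def IsSepSet {V : Type*} (Γ : SimpleGraph V) (T : Set V) : Prop :=
  numComponents Γ < numComponents (Γ.induce Tᶜ)

/-- A separating set is minimal if no nonempty proper subset of it is separating. -/
def IsMinimalSepSet {V : Type*} (Γ : SimpleGraph V) (T : Set V) : Prop :=
  IsSepSet Γ T ∧ ∀ S : Set V, S ⊆ T → S ≠ T → S.Nonempty → ¬ IsSepSet Γ S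

/-- A separating set of least cardinality. -/
def IsMinimumSepSet {V : Type*} (Γ : SimpleGraph V) (T : Set V) : Prop :=
  IsSepSet Γ T ∧ ∀ S : Set V, IsSepSet Γ S → T.ncard ≤ S.ncard

/-- Vertex connectivity: the least number of vertices whose removal leaves a
disconnected or one-vertex graph. -/
noncomputable def kappa {V : Type*} (Γ : SimpleGraph V) : ℕ :=
  sInf {k | ∃ S : Set V, S.ncard = k ∧
    (¬ (Γ.induce Sᶜ).Preconnected ∨ (Sᶜ : Set V).ncard = 1)}

/-- `𝒮(ℤ_n)`: the identity together with the generators of `ℤ_n`. -/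
def genSet (n : ℕ) : Set (ZMod n) :=
  {x | AddSubgroup.zmultiples x = ⊤} ∪ {0}

/-- `ℤ̃_n = ℤ_n − 𝒮(ℤ_n)`. -/
def tildeVerts (n : ℕ) : Set (ZMod n) := (genSet n)ᶜ

/-- `𝒢̃(ℤ_n)`: the subgraph of the power graph induced on `ℤ̃_n`. -/
def tildeGraph (n : ℕ) : SimpleGraph (tildeVerts n) :=
  (powerGraphZ n).induce (tildeVerts n)

/-- The `≈`-class of `x`: elements generating the same cyclic subgroup. -/
def simClass {G : Type*} [Group G] (x : G) : Set G :=
  {y | Subgroup.zpowers y = Subgroup.zpowers x}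

/-- The `≈`-class in `ℤ_n`. -/
def simClassZ {n : ℕ} (x : ZMod n) : Set (ZMod n) :=
  {y | AddSubgroup.zmultiples y = AddSubgroup.zmultiples x}

/-- Neighbourhood of a set of vertices: vertices adjacent to some element of `A`,
excluding `A` itself. -/
def setNbhd {V : Type*} (Γ : SimpleGraph V) (A : Set V) : Set V :=
  (⋃ a ∈ A, Γ.neighborSet a) \ A

/-- The proper power graph: the power graph with the identity removed. -/
def properPowerGraph (G : Type*) [Group G] : SimpleGraph ({g : G | g ≠ 1}) :=
  (powerGraph G).induce {g : G | g ≠ 1}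

theorem numComponents_le_of_surj {V W : Type*} [Finite V] (A : SimpleGraph V) (B : SimpleGraph W)
    (f : V → W) (hf : Function.Surjective f) (h : ∀ u v, A.Adj u v → B.Reachable (f u) (f v)) :
    numComponents B ≤ numComponents A := by
  have h2 : ∀ u v, A.Reachable u v → B.Reachable (f u) (f v) := by
    rintro u v ⟨p⟩
    induction p with
    | nil => exact SimpleGraph.Reachable.refl _
    | cons hadj _ ih => exact (h _ _ hadj).trans ih
  have : Finite A.ConnectedComponent := Quot.finite _
  refine Nat.card_le_card_of_surjective
    (Quot.lift (fun v => B.connectedComponentMk (f v))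
      (fun u v huv => SimpleGraph.ConnectedComponent.sound (h2 u v huv)) :
        A.ConnectedComponent → B.ConnectedComponent) ?_
  intro c
  induction c using SimpleGraph.ConnectedComponent.ind with
  | _ w =>
    obtain ⟨v, rfl⟩ := hf w
    exact ⟨A.connectedComponentMk v, rfl⟩

theorem minimal_sep_closed {G : Type*} [Group G] [Finite G] (T : Set G)
    (hT : IsMinimalSepSet (powerGraph G) T) (a b : G) (ha : a ∈ T)
    (hab : Subgroup.zpowers b = Subgroup.zpowers a) : b ∈ T := by
  classical
  by_contra hb
  have hle : numComponents ((powerGraph G).induce Tᶜ) ≤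
      numComponents ((powerGraph G).induce (T \ {a})ᶜ) := by
    have hr : ∀ u : ↥((T \ {a})ᶜ : Set G), (if u.1 = a then b else u.1) ∈ Tᶜ := by
      rintro ⟨u, hu⟩
      by_cases h : u = a
      · simpa [h] using hb
      · simp only [h, if_false]
        intro hT'
        exact hu ⟨hT', h⟩
    have hz : ∀ u : G, Subgroup.zpowers (if u = a then b else u) = Subgroup.zpowers u := by
      intro u
      split_ifs with h
      · rw [h, hab]
      · rfl
    refine numComponents_le_of_surj _ _ (fun u => ⟨_, hr u⟩) ?_ ?_
    · rintro ⟨w, hw⟩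
      have hwa : w ≠ a := fun h => hw (h ▸ ha)
      exact ⟨⟨w, fun h => hw h.1⟩, by simp [hwa]⟩
    · intro u v huv
      have huv' : u.1 ≠ v.1 ∧ (u.1 ∈ Subgroup.zpowers v.1 ∨ v.1 ∈ Subgroup.zpowers u.1) := huv
      by_cases he : (if u.1 = a then b else u.1) = (if v.1 = a then b else v.1)
      · have : (⟨_, hr u⟩ : ↥(Tᶜ : Set G)) = ⟨_, hr v⟩ := Subtype.ext he
        simp only [this]
        exact SimpleGraph.Reachable.refl _
      · refine SimpleGraph.Adj.reachable ?_
        refine ⟨he, ?_⟩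
        have := huv'.2
        simp only [← Subgroup.zpowers_le] at this ⊢
        simpa only [Function.Embedding.subtype_apply, hz] using this
  have hsep : IsSepSet (powerGraph G) (T \ {a}) := lt_of_lt_of_le hT.1 hle
  rcases (T \ {a}).eq_empty_or_nonempty with h0 | h0
  · rw [h0] at hsep
    refine absurd hsep (not_lt.mpr ?_)
    exact numComponents_le_of_surj _ _ (fun u => ⟨u, fun h => h⟩)
      (fun w => ⟨w.1, rfl⟩) (fun u v huv => SimpleGraph.Adj.reachable huv)
  · refine hT.2 _ Set.diff_subset ?_ h0 hsep
    intro h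
    rw [← h] at ha
    exact ha.2 rfl

theorem stmt3 {G : Type*} [Group G] [Finite G] (T : Set G)
    (hT : IsMinimalSepSet (powerGraph G) T) :
    (∀ x : G, simClass x ⊆ T ∨ simClass x ∩ T = ∅) ∧
    T = ⋃ x ∈ T, simClass x := by
  constructor
  · intro x
    by_cases h : simClass x ∩ T = ∅
    · exact Or.inr h
    · left
      obtain ⟨a, hax, haT⟩ := Set.nonempty_iff_ne_empty.mpr h
      intro b hb
      exact minimal_sep_closed T hT a b haT (Eq.trans hb (Eq.symm hax))
  · ext y
    simp only [Set.mem_iUnion]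
    constructor
    · intro hy
      exact ⟨y, hy, rfl⟩
    · rintro ⟨x, hx, hyx⟩
      exact minimal_sep_closed T hT x y hx hyx
end

section
/- Suppose n is not a product of two primes and n = p_1^{α_1} p_2^{α_2} ⋯ p_r^{α_r}, where r ≥ 2, p_1 < p_2 < ⋯ < p_r are primes and α_i ∈ ℕ. Define ξ_1(n) = φ(n) + n/p_r − p_r^{α_r −1} φ(n/p_r^{α_r}) and ξ_2(n) = φ(n) + n/p_r^{α_r} + φ(n/p_r^{α_r})(p_r^{α_r −1} − 2). Then: (i) ξ_2(n) = ξ_1(n) if and only if α_r = 1, or r = 2 and p_1 = 2; (ii) ξ_2(n) < ξ_1(n) if and only if α_r ≥ 2 and ∏_{i=1}^{r−1} (1 − 1/p_i) < 1/2; (iii) ξ_2(n) > ξ_1(n) if and only if α_r ≥ 2 and ∏_{i=1}^{r−1} (1 − 1/p_i) > 1/2. -/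
open SimpleGraph

/-- comparison of the two upper bounds `ξ₁(n)` and `ξ₂(n)`,
where `P` is the largest prime factor of `n` with multiplicity `α_r`:
(i) `ξ₂ = ξ₁` iff `α_r = 1`, or `r = 2` and `p₁ = 2`;
(ii) `ξ₂ < ξ₁` iff `α_r ≥ 2` and `∏_{i<r} (1 − 1/p_i) < 1/2`;
(iii) `ξ₂ > ξ₁` iff `α_r ≥ 2` and `∏_{i<r} (1 − 1/p_i) > 1/2`. -/
theorem stmt13 (n : ℕ) (hn : 2 ≤ n.primeFactors.card)
    (hn2 : ¬ ∃ p q : ℕ, p.Prime ∧ q.Prime ∧ n = p * q)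
    (P : ℕ) (hP : P ∈ n.primeFactors) (hPmax : ∀ q ∈ n.primeFactors, q ≤ P)
    (ξ1 ξ2 : ℤ)
    (hξ1 : ξ1 = (Nat.totient n : ℤ) + ((n / P : ℕ) : ℤ)
        - (P : ℤ) ^ (n.factorization P - 1)
          * (Nat.totient (n / P ^ n.factorization P) : ℤ))
    (hξ2 : ξ2 = (Nat.totient n : ℤ) + ((n / P ^ n.factorization P : ℕ) : ℤ)
        + (Nat.totient (n / P ^ n.factorization P) : ℤ)
          * ((P : ℤ) ^ (n.factorization P - 1) - 2)) :
    (ξ2 = ξ1 ↔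
      (n.factorization P = 1 ∨ (n.primeFactors.card = 2 ∧ 2 ∈ n.primeFactors))) ∧
    (ξ2 < ξ1 ↔
      (2 ≤ n.factorization P ∧
        ∏ q ∈ n.primeFactors.erase P, (1 - 1 / (q : ℚ)) < 1 / 2)) ∧
    (ξ1 < ξ2 ↔
      (2 ≤ n.factorization P ∧
        (1 : ℚ) / 2 < ∏ q ∈ n.primeFactors.erase P, (1 - 1 / (q : ℚ)))) := by
  have hPp : P.Prime := Nat.prime_of_mem_primeFactors hP
  have hn0 : n ≠ 0 := by
    rintro rfl
    simp at hP
  have hSm : (n / P ^ n.factorization P).primeFactors = n.primeFactors.erase P := by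
    rw [← Nat.support_factorization, Nat.factorization_ordCompl, Finsupp.support_erase,
      Nat.support_factorization]
  have hmul := Nat.ordProj_mul_ordCompl_eq_self n P
  have ha1 : 1 ≤ n.factorization P :=
    (hPp.dvd_iff_one_le_factorization hn0).1 (Nat.dvd_of_mem_primeFactors hP)
  have hm0 : 0 < n / P ^ n.factorization P := Nat.ordCompl_pos P hn0
  have hScard : (n.primeFactors.erase P).card = n.primeFactors.card - 1 :=
    Finset.card_erase_of_mem hP
  generalize hm : n / P ^ n.factorization P = m at *
  have htot := Nat.totient_eq_mul_prod_factors m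
  rw [hSm] at htot
  generalize ha : n.factorization P = a at *
  obtain ⟨b, rfl⟩ : ∃ b, a = b + 1 := ⟨a - 1, by omega⟩
  have hnP : n / P = P ^ b * m := by
    rw [← hmul]
    apply Nat.div_eq_of_eq_mul_right hPp.pos
    ring
  rw [hnP] at hξ1
  simp only [Nat.add_sub_cancel] at hξ1 hξ2
  have hdiff : ξ2 - ξ1 = ((P : ℤ) ^ b - 1) * (2 * (m.totient : ℤ) - m) := by
    rw [hξ1, hξ2]
    push_cast
    ring
  set S := n.primeFactors.erase P with hS
  have hSprime : ∀ q ∈ S, q.Prime := fun q hq =>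
    Nat.prime_of_mem_primeFactors (Finset.mem_of_mem_erase hq)
  have hprod : ∏ q ∈ S, (1 - 1 / (q : ℚ)) = ∏ q ∈ S, (1 - (q : ℚ)⁻¹) := by simp
  rw [← hprod] at htot
  have hmQ : (0 : ℚ) < m := by exact_mod_cast hm0
  set X : ℚ := ∏ q ∈ S, (1 - 1 / (q : ℚ)) with hX
  have hlt : 2 * (m.totient : ℤ) - m < 0 ↔ X < 1 / 2 := by
    rw [← Int.cast_lt (R := ℚ)]
    push_cast
    rw [htot]
    constructor <;> intro h <;> nlinarith
  have hgt : 0 < 2 * (m.totient : ℤ) - m ↔ 1 / 2 < X := by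
    rw [← Int.cast_lt (R := ℚ)]
    push_cast
    rw [htot]
    constructor <;> intro h <;> nlinarith
  have heq : 2 * (m.totient : ℤ) - m = 0 ↔ (n.primeFactors.card = 2 ∧ 2 ∈ n.primeFactors) := by
    constructor
    · intro h
      have h2m : 2 ∣ m := ⟨m.totient, by omega⟩
      have h2S : 2 ∈ S := by
        rw [← hSm]
        exact Nat.mem_primeFactors.2 ⟨Nat.prime_two, h2m, hm0.ne'⟩
      refine ⟨?_, Finset.mem_of_mem_erase h2S⟩
      by_contra hc
      have hXe : X = 1 / 2 := by
        have h1 : ¬ X < 1 / 2 := fun hh => by have := hlt.2 hh; omega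
        have h3 : ¬ 1 / 2 < X := fun hh => by have := hgt.2 hh; omega
        exact le_antisymm (not_lt.1 h3) (not_lt.1 h1)
      have hc2 : 0 < (S.erase 2).card := by
        rw [Finset.card_erase_of_mem h2S]; omega
      obtain ⟨t, ht⟩ := Finset.card_pos.1 hc2
      have htp := hSprime t (Finset.mem_of_mem_erase ht)
      have e1 := Finset.mul_prod_erase S (fun q : ℕ => 1 - 1 / (q : ℚ)) h2S
      have e2 := Finset.mul_prod_erase (S.erase 2) (fun q : ℕ => 1 - 1 / (q : ℚ)) ht
      have hb : ∀ q ∈ (S.erase 2).erase t, 0 ≤ 1 - 1 / (q : ℚ) ∧ 1 - 1 / (q : ℚ) ≤ 1 := by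
        intro q hq
        have hq := hSprime q (Finset.mem_of_mem_erase (Finset.mem_of_mem_erase hq))
        have : (1 : ℚ) ≤ q := by exact_mod_cast hq.one_le
        have h0 : 1 / (q : ℚ) ≤ 1 := by rw [div_le_one (by linarith)]; exact this
        have h1 : 0 ≤ 1 / (q : ℚ) := by positivity
        constructor <;> linarith
      have hle := Finset.prod_le_one (fun q hq => (hb q hq).1) (fun q hq => (hb q hq).2)
      have htQ : (0 : ℚ) < 1 / (t : ℚ) := by
        have : (0 : ℚ) < t := by exact_mod_cast htp.pos
        positivity
      have ht1 : 1 / (t : ℚ) ≤ 1 := by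
        have : (1 : ℚ) ≤ t := by exact_mod_cast htp.one_le
        rw [div_le_one (by linarith)]; exact this
      rw [← hX, hXe, ← e2] at e1
      push_cast at e1
      nlinarith
    · rintro ⟨hc, h2⟩
      have h2S : 2 ∈ S := by
        refine Finset.mem_erase.2 ⟨?_, h2⟩
        rintro rfl
        obtain ⟨t, ht⟩ := Finset.card_pos.1 (show 0 < S.card by omega)
        have h1 := hPmax t (Finset.mem_of_mem_erase ht)
        have h3 := (hSprime t ht).two_le
        exact Finset.ne_of_mem_erase ht (by omega)
      obtain ⟨x, hx⟩ := Finset.card_eq_one.1 (show S.card = 1 by omega)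
      have hx2 : x = 2 := by
        rw [hx] at h2S
        exact (Finset.mem_singleton.1 h2S).symm
      have hXe : X = 1 / 2 := by
        rw [hX, hx, hx2]
        norm_num
      have h1 : ¬ 2 * (m.totient : ℤ) - m < 0 := fun hh => by
        have := hlt.1 hh
        linarith
      have h3 : ¬ 0 < 2 * (m.totient : ℤ) - m := fun hh => by
        have := hgt.1 hh
        linarith
      omega
  rw [← heq, ← hlt, ← hgt]
  clear_value X
  rcases Nat.eq_zero_or_pos b with rfl | hb
  · simp only [pow_zero, sub_self, zero_mul] at hdiff
    refine ⟨⟨fun _ => Or.inl rfl, fun _ => by omega⟩, ⟨fun h => by omega, fun h => by omega⟩,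
      ⟨fun h => by omega, fun h => by omega⟩⟩
  · have hpos : (0 : ℤ) < (P : ℤ) ^ b - 1 := by
      have : 1 < P ^ b := Nat.one_lt_pow hb.ne' hPp.one_lt
      have : (1 : ℤ) < (P : ℤ) ^ b := by exact_mod_cast this
      linarith
    generalize 2 * (m.totient : ℤ) - m = D at *
    refine ⟨?_, ?_, ?_⟩
    · rw [← sub_eq_zero, hdiff, mul_eq_zero]
      constructor
      · rintro (h | h)
        · omega
        · exact Or.inr h
      · rintro (h | h)
        · omega
        · exact Or.inr h
    · rw [← sub_neg, hdiff, mul_neg_iff]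
      constructor
      · rintro (h | h)
        · exact ⟨by omega, h.2⟩
        · omega
      · exact fun h => Or.inl ⟨hpos, h.2⟩
    · rw [← sub_pos, hdiff, mul_pos_iff_of_pos_left hpos]
      exact ⟨fun h => ⟨by omega, h⟩, fun h => h.2⟩
end

section
/- If G is a cyclic group of order n = 2^α p^β, where p is an odd prime and α, β ∈ ℕ, then κ(𝒢(G)) = n/2. -/
open SimpleGraph

theorem pg_reach {G : Type*} [Group G] {S : Set G} {x y : G} (hx : x ∈ Sᶜ) (hy : y ∈ Sᶜ)
    (h : x ∈ Subgroup.zpowers y ∨ y ∈ Subgroup.zpowers x) :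
    ((powerGraph G).induce Sᶜ).Reachable ⟨x, hx⟩ ⟨y, hy⟩ := by
  by_cases hxy : x = y
  · subst hxy; exact Reachable.refl _
  · apply SimpleGraph.Adj.reachable
    exact ⟨hxy, h⟩

theorem pg_count {G : Type*} [Group G] [Finite G] (H K : Subgroup G) (hH : H.index = 2)
    (a : G) (haH : a ∉ H) (haK : a ∈ K) :
    (((H : Set G)ᶜ \ K) ∪ ((H : Set G) ∩ K)).ncard = Nat.card G / 2 ∧
      ((H : Set G)ᶜ).ncard = Nat.card G / 2 := by
  have h1 : ((H : Set G)ᶜ).ncard = Nat.card G / 2 := by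
    have e1 := H.card_mul_index
    have e2 := Set.ncard_add_ncard_compl (H : Set G)
    have e3 : (H : Set G).ncard = Nat.card H := rfl
    rw [hH] at e1
    omega
  refine ⟨?_, h1⟩
  have h2 : ((fun x => a * x) '' ((H : Set G) ∩ K)) = (H : Set G)ᶜ ∩ K := by
    ext x
    constructor
    · rintro ⟨y, ⟨hy, hy'⟩, rfl⟩
      refine ⟨fun h => haH ?_, K.mul_mem haK hy'⟩
      exact (H.mul_mem_cancel_right hy).1 h
    · rintro ⟨hx, hx'⟩
      refine ⟨a⁻¹ * x, ⟨?_, K.mul_mem (K.inv_mem haK) hx'⟩, by simp⟩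
      have := Subgroup.mul_mem_iff_of_index_two hH (a := a⁻¹) (b := x)
      have h3 : a⁻¹ ∉ H := by simpa using haH
      exact this.2 (iff_of_false h3 hx)
  have h3 : ((H : Set G) ∩ K).ncard = ((H : Set G)ᶜ ∩ K).ncard := by
    rw [← h2, Set.ncard_image_of_injective _ (mul_right_injective a)]
  rw [Set.ncard_union_eq, h3, ← h1, add_comm, Set.ncard_inter_add_ncard_sdiff_eq_ncard]
  · rw [Set.disjoint_left]
    rintro x ⟨h, -⟩ ⟨h', -⟩
    exact h h'

theorem pg_mem {G : Type*} [Group G] [Finite G] [hG : IsCyclic G] {x y : G}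
    (h : orderOf x ∣ orderOf y) : x ∈ Subgroup.zpowers y := by
  obtain ⟨g, hg⟩ := hG.exists_generator
  have hc : Nat.card (Subgroup.zpowers y) = orderOf y := Nat.card_zpowers y
  classical
  have := Fintype.ofFinite G
  have h1 := IsCyclic.card_pow_eq_one_le (α := G) (n := orderOf y) (orderOf_pos y)
  have h2 : (Subgroup.zpowers y : Set G) = {a : G | a ^ orderOf y = 1} := by
    apply Set.eq_of_subset_of_ncard_le
    · intro z hz
      exact orderOf_dvd_iff_pow_eq_one.1 (orderOf_dvd_of_mem_zpowers hz)
    · have e3 : (Subgroup.zpowers y : Set G).ncard = orderOf y := hc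
      rw [e3]
      convert h1
      rw [← Set.ncard_coe_finset]; simp
    · exact Set.toFinite _
  have : x ∈ (Subgroup.zpowers y : Set G) := by
    rw [h2]; exact orderOf_dvd_iff_pow_eq_one.1 h
  exact this

theorem pg_lower {G : Type*} [Group G] [Finite G] (hG : IsCyclic G)
    (p α β : ℕ) (hp : p.Prime) (hodd : Odd p) (hβ : 1 ≤ β)
    (hcard : Nat.card G = 2 ^ (α + 1) * p ^ β) (S : Set G)
    (hS : S.ncard < Nat.card G / 2) : ((powerGraph G).induce Sᶜ).Preconnected := by
  have hn2 : Nat.card G / 2 = 2 ^ α * p ^ β := by 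
    rw [hcard, pow_succ]
    rw [show 2 ^ α * 2 * p ^ β = 2 * (2 ^ α * p ^ β) by ring]; simp
  have key : ∀ c : G, ∀ hc : c ∈ Sᶜ, (∀ x, ∀ hx : x ∈ Sᶜ,
      ((powerGraph G).induce Sᶜ).Reachable ⟨x, hx⟩ ⟨c, hc⟩) →
      ((powerGraph G).induce Sᶜ).Preconnected := by
    intro c hc h x y
    exact (h x.1 x.2).trans (h y.1 y.2).symm
  by_cases hgen : ∃ g, orderOf g = Nat.card G ∧ g ∈ Sᶜ
  · obtain ⟨g, hg, hgS⟩ := hgen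
    refine key g hgS fun x hx => pg_reach _ _ (Or.inl (pg_mem ?_))
    rw [hg]; exact orderOf_dvd_natCard x
  by_cases hM : ∃ b, orderOf b = 2 ^ α * p ^ β ∧ b ∈ Sᶜ
  swap
  · exfalso
    push Not at hgen hM
    classical
    have := Fintype.ofFinite G
    have c1 := IsCyclic.card_orderOf_eq_totient (α := G) (d := Nat.card G) (by simp)
    have c2 := IsCyclic.card_orderOf_eq_totient (α := G) (d := 2 ^ α * p ^ β)
      (by rw [← Nat.card_eq_fintype_card, hcard, pow_succ]; exact ⟨2, by ring⟩)
    have hlt : 2 ^ α * p ^ β < Nat.card G := by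
      have : 0 < 2 ^ α * p ^ β := Nat.mul_pos (by positivity) (pow_pos hp.pos _)
      omega
    have hsub : ((Finset.univ.filter fun a : G => orderOf a = Nat.card G) ∪
      (Finset.univ.filter fun a : G => orderOf a = 2 ^ α * p ^ β) : Finset G).card ≤ S.ncard := by
      rw [← Set.ncard_coe_finset]
      apply Set.ncard_le_ncard _ (Set.toFinite _)
      intro x hx
      simp at hx
      rcases hx with hx | hx
      · simpa using hgen x (by simpa using hx)
      · simpa using hM x hx
    rw [Finset.card_union_of_disjoint, c1, c2, hcard] at hsub
    swap
    · rw [Finset.disjoint_left]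
      intro x hx hx'
      simp only [Finset.mem_filter] at hx hx'
      omega
    have hcop : ∀ k, Nat.Coprime (2 ^ k) (p ^ β) := fun k =>
      Nat.Coprime.pow _ _ (Nat.coprime_two_left.2 hodd)
    rw [Nat.totient_mul (hcop _), Nat.totient_mul (hcop _),
      Nat.totient_prime_pow Nat.prime_two (by omega), Nat.totient_prime_pow hp hβ] at hsub
    have hp3 : 3 ≤ p := by
      have := hp.two_le
      rcases hodd with ⟨k, hk⟩
      omega
    obtain ⟨q, rfl⟩ : ∃ q, p = q + 1 := ⟨p - 1, by omega⟩
    obtain ⟨b, rfl⟩ : ∃ b, β = b + 1 := ⟨β - 1, by omega⟩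
    simp only [Nat.add_sub_cancel] at hsub
    have ht : 2 ^ α ≤ 2 * Nat.totient (2 ^ α) := by
      cases α with
      | zero => simp
      | succ k => rw [Nat.totient_prime_pow_succ Nat.prime_two, pow_succ]; omega
    rw [hn2, pow_succ] at hS
    have hP : 0 < (q + 1) ^ b := by positivity
    generalize (q + 1) ^ b = P at *
    generalize Nat.totient (2 ^ α) = T at *
    generalize (2 : ℕ) ^ α = A at *
    have f1 : A * (P * q) ≤ 2 * T * (P * q) := Nat.mul_le_mul_right _ ht
    have f2 : A * P * 2 ≤ A * P * q := Nat.mul_le_mul_left _ (by omega)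
    have f3 : A * (2 - 1) * (P * q) = A * (P * q) := by norm_num
    rw [f3] at hsub
    have f4 : A * (P * (q + 1)) = A * (P * q) + A * P := by ring
    have f5 : A * P * q = A * (P * q) := by ring
    have f6 : 2 * T * (P * q) = 2 * (T * (P * q)) := by ring
    have f7 := lt_of_le_of_lt hsub hS
    omega
  obtain ⟨b, hb, hbS⟩ := hM
  have hcb : Nat.card (Subgroup.zpowers b) = 2 ^ α * p ^ β := by rw [Nat.card_zpowers, hb]
  have hidx : (Subgroup.zpowers b).index = 2 := by
    have e1 := (Subgroup.zpowers b).card_mul_index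
    rw [hcb, hcard] at e1
    have : 0 < 2 ^ α * p ^ β := Nat.mul_pos (by positivity) (pow_pos hp.pos _)
    apply Nat.eq_of_mul_eq_mul_left this
    rw [e1]; ring
  have hord : ∀ x : G, x ∉ Subgroup.zpowers b → ∃ j, orderOf x = 2 ^ (α + 1) * p ^ j := by
    intro x hx
    have h1 : orderOf x ∣ 2 ^ (α + 1) * p ^ β := hcard ▸ orderOf_dvd_natCard x
    obtain ⟨u, v, hu, hv, huv⟩ := (Nat.dvd_mul).1 h1
    obtain ⟨i, hi, rfl⟩ := (Nat.dvd_prime_pow Nat.prime_two).1 hu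
    obtain ⟨j, hj, rfl⟩ := (Nat.dvd_prime_pow hp).1 hv
    refine ⟨j, ?_⟩
    have : i = α + 1 := by
      by_contra hne
      apply hx
      apply pg_mem
      rw [hb, ← huv]
      exact Nat.mul_dvd_mul (pow_dvd_pow _ (by omega)) (pow_dvd_pow _ hj)
    rw [← huv, this]
  by_cases ha : ∃ a, a ∈ Sᶜ ∧ a ∉ Subgroup.zpowers b
  swap
  · exfalso
    push Not at ha
    obtain ⟨a, haH⟩ : ∃ a, a ∉ Subgroup.zpowers b := by
      by_contra hcon
      push Not at hcon
      have : Subgroup.zpowers b = ⊤ := by ext; simp [hcon]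
      rw [this] at hidx; simp at hidx
    have hc := (pg_count _ ⊤ hidx a haH (by simp)).2
    have : ((Subgroup.zpowers b : Set G)ᶜ).ncard ≤ S.ncard := by
      apply Set.ncard_le_ncard _ (Set.toFinite _)
      intro x hx
      by_contra hxS
      exact hx (ha x hxS)
    omega
  obtain ⟨a, ⟨haS, haH⟩, hmax⟩ := Set.exists_max_image {a | a ∈ Sᶜ ∧ a ∉ Subgroup.zpowers b}
    orderOf (Set.toFinite _) ha
  have hK : ∀ x ∈ Sᶜ, x ∉ Subgroup.zpowers b → x ∈ Subgroup.zpowers a := by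
    intro x hx hxH
    apply pg_mem
    have := hmax x ⟨hx, hxH⟩
    obtain ⟨j, hj⟩ := hord x hxH
    obtain ⟨k, hk⟩ := hord a haH
    rw [hj, hk] at this ⊢
    have h2 := Nat.le_of_mul_le_mul_left this (by positivity)
    exact Nat.mul_dvd_mul_left _ (pow_dvd_pow _ ((Nat.pow_le_pow_iff_right hp.one_lt).1 h2))
  by_cases hc : ∃ c, c ∈ Sᶜ ∧ c ∈ Subgroup.zpowers b ∧ c ∈ Subgroup.zpowers a
  · obtain ⟨c, hcS, hcb, hca⟩ := hc
    refine key c hcS fun x hx => ?_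
    by_cases hxH : x ∈ Subgroup.zpowers b
    · exact (pg_reach hx hbS (Or.inl hxH)).trans (pg_reach hbS hcS (Or.inr hcb))
    · exact (pg_reach hx haS (Or.inl (hK x hx hxH))).trans (pg_reach haS hcS (Or.inr hca))
  · exfalso
    have hct := (pg_count _ (Subgroup.zpowers a) hidx a haH (Subgroup.mem_zpowers a)).1
    have : (((Subgroup.zpowers b : Set G)ᶜ \ (Subgroup.zpowers a : Set G)) ∪
        ((Subgroup.zpowers b : Set G) ∩ (Subgroup.zpowers a : Set G))).ncard ≤ S.ncard := by
      apply Set.ncard_le_ncard _ (Set.toFinite _)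
      rintro x (⟨h1, h2⟩ | ⟨h1, h2⟩)
      · by_contra hxS
        exact h2 (hK x hxS h1)
      · by_contra hxS
        exact hc ⟨x, hxS, h1, h2⟩
    omega

theorem pg_upper {G : Type*} [Group G] [Finite G] (hG : IsCyclic G)
    (p α β : ℕ) (hp : p.Prime) (hodd : Odd p) (hβ : 1 ≤ β)
    (hcard : Nat.card G = 2 ^ (α + 1) * p ^ β) : ∃ S : Set G,
    S.ncard = Nat.card G / 2 ∧ ¬ ((powerGraph G).induce Sᶜ).Preconnected := by
  obtain ⟨g, hg⟩ := hG.exists_generator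
  have hgo : orderOf g = 2 ^ (α + 1) * p ^ β := by
    rw [← hcard]; exact orderOf_eq_card_of_forall_mem_zpowers hg
  have hb : orderOf (g ^ 2) = 2 ^ α * p ^ β := by
    rw [orderOf_pow_of_dvd (by norm_num) (by rw [hgo, pow_succ]; exact ⟨2 ^ α * p ^ β, by ring⟩), hgo]
    rw [pow_succ, show 2 ^ α * 2 * p ^ β = 2 * (2 ^ α * p ^ β) by ring]; simp
  have ha : orderOf (g ^ (p ^ β)) = 2 ^ (α + 1) := by
    rw [orderOf_pow_of_dvd (pow_pos hp.pos _).ne' (by rw [hgo]; exact ⟨2 ^ (α + 1), by ring⟩), hgo]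
    exact Nat.mul_div_cancel _ (pow_pos hp.pos _)
  generalize g ^ 2 = b at hb
  generalize g ^ (p ^ β) = a at ha
  have hcop : ∀ k, Nat.Coprime (2 ^ k) (p ^ β) := fun k =>
      Nat.Coprime.pow _ _ (Nat.coprime_two_left.2 hodd)
  have haH : a ∉ Subgroup.zpowers b := by
    intro h
    have := orderOf_dvd_of_mem_zpowers h
    rw [ha, hb] at this
    have := (hcop _).dvd_of_dvd_mul_right this
    rw [Nat.pow_dvd_pow_iff_le_right (by norm_num)] at this
    omega
  have hbK : b ∉ Subgroup.zpowers a := by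
    intro h
    have := orderOf_dvd_of_mem_zpowers h
    rw [ha, hb] at this
    have h1 := (hcop (α + 1)).symm.eq_one_of_dvd ((Dvd.intro_left _ rfl).trans this)
    have := Nat.one_lt_pow (n := β) (by omega) hp.one_lt
    omega
  have hcb : Nat.card (Subgroup.zpowers b) = 2 ^ α * p ^ β := by rw [Nat.card_zpowers, hb]
  have hidx : (Subgroup.zpowers b).index = 2 := by
    have e1 := (Subgroup.zpowers b).card_mul_index
    rw [hcb, hcard] at e1
    have : 0 < 2 ^ α * p ^ β := Nat.mul_pos (by positivity) (pow_pos hp.pos _)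
    apply Nat.eq_of_mul_eq_mul_left this
    rw [e1]; ring
  refine ⟨_, (pg_count _ (Subgroup.zpowers a) hidx a haH (Subgroup.mem_zpowers a)).1, ?_⟩
  set S := (((Subgroup.zpowers b : Set G)ᶜ \ (Subgroup.zpowers a : Set G)) ∪
        ((Subgroup.zpowers b : Set G) ∩ (Subgroup.zpowers a : Set G))) with hSdef
  intro hpre
  have hmemS : ∀ x, x ∈ Sᶜ ↔ ¬ (x ∈ Subgroup.zpowers b ↔ x ∈ Subgroup.zpowers a) := by
    intro x
    simp only [hSdef, Set.mem_compl_iff, Set.mem_union, Set.mem_sdiff, Set.mem_inter_iff,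
      SetLike.mem_coe]
    tauto
  have haS : a ∈ Sᶜ := by rw [hmemS]; simp [haH]
  have hbS : b ∈ Sᶜ := by rw [hmemS]; simp [hbK]
  have inv : ∀ x y : (Sᶜ : Set G), ((powerGraph G).induce Sᶜ).Walk x y →
      x.1 ∈ Subgroup.zpowers a → y.1 ∈ Subgroup.zpowers a := by
    intro x y w
    induction w with
    | nil => exact id
    | @cons u v w h _ ih =>
      intro hu
      apply ih
      have hu' := (hmemS _).1 u.2
      have hv' := (hmemS _).1 v.2
      obtain ⟨-, h | h⟩ := h
      · by_contra hv
        have hvb : v.1 ∈ Subgroup.zpowers b := by tauto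
        have : u.1 ∈ Subgroup.zpowers b := (Subgroup.zpowers_le.2 hvb) h
        tauto
      · exact (Subgroup.zpowers_le.2 hu) h
  obtain ⟨w⟩ := hpre ⟨a, haS⟩ ⟨b, hbS⟩
  exact hbK (inv _ _ w (Subgroup.mem_zpowers a))

/-- If `G` is a cyclic group of order `n = 2^α p^β` with `p` an odd
prime and `α, β ≥ 1`, then `κ(𝒢(G)) = n/2`. -/
theorem stmt15 {G : Type*} [Group G] [Finite G] (hG : IsCyclic G)
    (p α β : ℕ) (hp : p.Prime) (hodd : Odd p) (hα : 1 ≤ α) (hβ : 1 ≤ β)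
    (hcard : Nat.card G = 2 ^ α * p ^ β) :
    kappa (powerGraph G) = Nat.card G / 2 := by
  obtain ⟨α, rfl⟩ : ∃ k, α = k + 1 := ⟨α - 1, by omega⟩
  obtain ⟨S, hS, hS'⟩ := pg_upper hG p α β hp hodd hβ hcard
  apply le_antisymm
  · exact Nat.sInf_le ⟨S, hS, Or.inl hS'⟩
  · unfold kappa
    refine le_csInf ⟨_, S, hS, Or.inl hS'⟩ ?_
    rintro k ⟨T, rfl, hT | hT⟩
    · by_contra hlt
      exact hT (pg_lower hG p α β hp hodd hβ hcard T (by omega))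
    · have := Set.ncard_add_ncard_compl T
      have h2 : 0 < 2 ^ α * p ^ β := Nat.mul_pos (by positivity) (pow_pos hp.pos _)
      have h3 : Nat.card G = 2 * (2 ^ α * p ^ β) := by rw [hcard]; ring
      omega
end

section
/- Let p be a prime, G a finite p-group (a finite group whose order is a power of p), and x ∈ G an element of order p. Then x is adjacent in the proper power graph 𝒢*(G) to every other vertex of the connected component of 𝒢*(G) containing x. -/
open SimpleGraph

theorem aux_pow_p {G : Type*} [Group G] (p n' : ℕ) (hp : p.Prime) (a y : G)
    (hn : orderOf a = p * n') (hy : y ∈ Subgroup.zpowers a) (hyp : y ^ p = 1) :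
    y ∈ Subgroup.zpowers (a ^ n') := by
  obtain ⟨i, rfl⟩ := Subgroup.mem_zpowers_iff.1 hy
  rw [← zpow_natCast, ← zpow_mul, ← orderOf_dvd_iff_zpow_eq_one, hn] at hyp
  have h0 : (p : ℤ) ≠ 0 := by exact_mod_cast hp.ne_zero
  have h : (n' : ℤ) ∣ i := by
    apply Int.dvd_of_mul_dvd_mul_left h0
    rw [mul_comm _ i]
    exact_mod_cast hyp
  obtain ⟨k, rfl⟩ := h
  refine Subgroup.mem_zpowers_iff.2 ⟨k, ?_⟩
  rw [zpow_mul, zpow_natCast]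

theorem aux_step {G : Type*} [Group G] [Finite G] (p : ℕ) (hp : p.Prime)
    (x a b : G) (hx : orderOf x = p) (hb : p ∣ orderOf b)
    (hxa : x ∈ Subgroup.zpowers a) (hba : b ∈ Subgroup.zpowers a) :
    x ∈ Subgroup.zpowers b := by
  obtain ⟨n', hn⟩ := hx ▸ orderOf_dvd_of_mem_zpowers hxa
  have hxc := aux_pow_p p n' hp a x hn hxa (hx ▸ pow_orderOf_eq_one x)
  obtain ⟨m, hm⟩ := hb
  have hm0 : m ≠ 0 := by
    rintro rfl
    exact (orderOf_pos b).ne' (by simpa using hm)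
  have hob : orderOf (b ^ m) = p := by
    rw [orderOf_pow_of_dvd hm0 ⟨p, by rw [hm, mul_comm]⟩, hm,
      Nat.mul_div_cancel _ (Nat.pos_of_ne_zero hm0)]
  have hbc := aux_pow_p p n' hp a (b ^ m) hn (Subgroup.pow_mem _ hba m)
    (by rw [← pow_mul, mul_comm, ← hm, pow_orderOf_eq_one])
  have hn0 : n' ≠ 0 := by
    rintro rfl
    exact (orderOf_pos a).ne' (by simpa using hn)
  have hoc : orderOf (a ^ n') = p := by
    rw [orderOf_pow_of_dvd hn0 ⟨p, by rw [hn, mul_comm]⟩, hn,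
      Nat.mul_div_cancel _ (Nat.pos_of_ne_zero hn0)]
  have heq : Subgroup.zpowers (b ^ m) = Subgroup.zpowers (a ^ n') := by
    apply Subgroup.eq_of_le_of_card_ge (Subgroup.zpowers_le.2 hbc)
    rw [Nat.card_zpowers, Nat.card_zpowers, hob, hoc]
  rw [← heq] at hxc
  exact Subgroup.zpowers_le.2 (Subgroup.pow_mem _ (Subgroup.mem_zpowers b) m) hxc

/-- In a finite `p`-group `G`, an element `x` of order `p` is adjacent
in the proper power graph `𝒢*(G)` to every other vertex of the connected component
of `𝒢*(G)` containing `x`. -/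
theorem stmt17 {G : Type*} [Group G] [Finite G] (p : ℕ) (hp : p.Prime)
    (hG : ∃ m : ℕ, Nat.card G = p ^ m)
    (x y : {g : G | g ≠ 1}) (hx : orderOf (x : G) = p)
    (hcomp : (properPowerGraph G).connectedComponentMk y
      = (properPowerGraph G).connectedComponentMk x)
    (hxy : y ≠ x) :
    (properPowerGraph G).Adj x y := by
  obtain ⟨m, hm⟩ := hG
  have key : ∀ u v : {g : G | g ≠ 1}, (properPowerGraph G).Walk u v →
      (x : G) ∈ Subgroup.zpowers (u : G) → (x : G) ∈ Subgroup.zpowers (v : G) := by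
    intro u v w
    induction w with
    | nil => exact id
    | @cons a b c hab _ ih =>
      intro hxa
      apply ih
      have hab' : (a : G) ≠ b ∧
        ((a : G) ∈ Subgroup.zpowers (b : G) ∨ (b : G) ∈ Subgroup.zpowers (a : G)) := hab
      rcases hab'.2 with h | h
      · exact Subgroup.zpowers_le.2 h hxa
      · refine aux_step p hp (x : G) (a : G) (b : G) hx ?_ hxa h
        obtain ⟨k, -, hk⟩ := (Nat.dvd_prime_pow hp).1 (hm ▸ orderOf_dvd_natCard (b : G))
        rw [hk]
        refine dvd_pow_self p ?_
        rintro rfl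
        exact b.2 (orderOf_eq_one_iff.1 (by simpa using hk))
  obtain ⟨w⟩ := (SimpleGraph.ConnectedComponent.eq.1 hcomp).symm
  exact ⟨fun h => hxy (Subtype.ext h.symm), Or.inl (key x y w (Subgroup.mem_zpowers _))⟩
end
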